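/- Let d be a positive natural number and let B be a d×d real matrix all of whose entries are 0 or 1. Assume every complex eigenvalue μ of B (i.e., every element of the spectrum over ℂ of the matrix obtained by mapping the entries of B into ℂ) satisfies |μ| < 1. Then the matrix I − B is invertible, and B is acyclic if and only if tr((I − B)⁻¹) = d. -/

import Mathlib

open scoped Matrix

/-- The directed graph induced by a matrix `B` (edge `i → j` iff `B i j ≠ 0`) is acyclic:
there is no `k ≥ 1` and sequence of vertices `i_0, …, i_k` with `i_0 = i_k` and
`B i_t i_{t+1} ≠ 0` for all `0 ≤ t < k`. -/
def Matrix.IsAcyclic {d : ℕ} (B : Matrix (Fin d) (Fin d) ℝ) : Prop :=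
  ¬ ∃ (k : ℕ) (f : ℕ → Fin d), 1 ≤ k ∧ f k = f 0 ∧ ∀ t < k, B (f t) (f (t + 1)) ≠ 0

open Filter Topology ENNReal in
/-- In a complex Banach algebra, the powers of an element of spectral radius less than one
tend to zero. -/
theorem tendsto_pow_zero_of_spectralRadius_lt_one {A : Type*} [NormedRing A] [NormedAlgebra ℂ A]
    [CompleteSpace A] {a : A} (ha : spectralRadius ℂ a < 1) :
    Tendsto (fun n : ℕ => a ^ n) atTop (𝓝 0) := by
  obtain ⟨r, hr, hr1⟩ := ENNReal.lt_iff_exists_nnreal_btwn.mp ha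
  have hr1' : (r : ℝ) < 1 := by exact_mod_cast hr1
  have hlt := (spectrum.pow_nnnorm_pow_one_div_tendsto_nhds_spectralRadius a).eventually_lt_const hr
  refine squeeze_zero_norm' ?_ (tendsto_pow_atTop_nhds_zero_of_lt_one r.coe_nonneg hr1')
  filter_upwards [hlt, eventually_gt_atTop 0] with n hn hn0
  have hn0' : (0 : ℝ) < n := by exact_mod_cast hn0
  rw [one_div, ENNReal.rpow_inv_lt_iff hn0', ENNReal.rpow_natCast] at hn
  exact_mod_cast hn.le

namespace Matrix

open Filter Topology in
/-- If all complex eigenvalues of a real square matrix lie in the open unit disc, then every entry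
of its powers tends to zero. -/
theorem tendsto_pow_apply_zero {n : Type*} [Fintype n] [DecidableEq n] {B : Matrix n n ℝ}
    (hspec : ∀ μ ∈ spectrum ℂ (B.map (algebraMap ℝ ℂ)), ‖μ‖ < 1) (i j : n) :
    Tendsto (fun k : ℕ => (B ^ k) i j) atTop (𝓝 0) := by
  let _ : NormedRing (Matrix n n ℂ) := Matrix.linftyOpNormedRing
  let _ : NormedAlgebra ℂ (Matrix n n ℂ) := Matrix.linftyOpNormedAlgebra
  have : Nonempty n := ⟨i⟩
  have : CompleteSpace (Matrix n n ℂ) := FiniteDimensional.complete ℂ _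
  have hrad : spectralRadius ℂ (B.map (algebraMap ℝ ℂ)) < 1 :=
    spectrum.spectralRadius_lt_of_forall_lt (r := 1) _ fun μ hμ => by
      exact_mod_cast hspec μ hμ
  have hlim := tendsto_pow_zero_of_spectralRadius_lt_one hrad
  have hentry : Continuous fun M : Matrix n n ℂ => (M i j).re :=
    (Complex.reLm ∘ₗ Matrix.entryLinearMap ℝ ℂ i j).continuous_of_finiteDimensional
  refine ((hentry.tendsto 0).comp hlim).congr' (Eventually.of_forall fun k => ?_) |>.trans (by simp)
  have hpow : (B.map (algebraMap ℝ ℂ)) ^ k = (B ^ k).map (algebraMap ℝ ℂ) :=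
    (map_pow (algebraMap ℝ ℂ).mapMatrix B k).symm
  exact congrArg (fun M : Matrix n n ℂ => (M i j).re) hpow

/-- If `1` is not a complex eigenvalue of a real square matrix `B`, then `1 - B` is invertible. -/
theorem isUnit_one_sub_of_one_notMem_spectrum {n : Type*} [Fintype n] [DecidableEq n]
    {B : Matrix n n ℝ} (h : (1 : ℂ) ∉ spectrum ℂ (B.map (algebraMap ℝ ℂ))) :
    IsUnit (1 - B) := by
  have hunit := spectrum.notMem_iff.mp h
  have hmap : algebraMap ℂ (Matrix n n ℂ) 1 - B.map (algebraMap ℝ ℂ)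
      = (algebraMap ℝ ℂ).mapMatrix (1 - B) := by
    rw [map_one, map_sub, map_one, RingHom.mapMatrix_apply]
  rw [hmap, Matrix.isUnit_iff_isUnit_det, ← RingHom.map_det, isUnit_map_iff] at hunit
  exact (Matrix.isUnit_iff_isUnit_det _).mpr hunit

/-- A nonzero entry of the `k`-th power of a matrix gives a walk of length `k`. -/
theorem exists_walk_of_pow_apply_ne_zero {n R : Type*} [Fintype n] [DecidableEq n] [Semiring R]
    {B : Matrix n n R} {k : ℕ} {i j : n} (h : (B ^ k) i j ≠ 0) :
    ∃ f : ℕ → n, f 0 = i ∧ f k = j ∧ ∀ t < k, B (f t) (f (t + 1)) ≠ 0 := by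
  induction k generalizing i with
  | zero =>
    have hij : i = j := by
      by_contra hne
      exact h (by simp [hne])
    exact ⟨fun _ => i, rfl, hij, by simp⟩
  | succ k ih =>
    rw [pow_succ', mul_apply] at h
    obtain ⟨l, -, hl⟩ := Finset.exists_ne_zero_of_sum_ne_zero h
    obtain ⟨f, hf0, hfk, hf⟩ := ih (right_ne_zero_of_mul hl)
    refine ⟨fun t => t.casesOn i f, rfl, hfk, fun t ht => ?_⟩
    cases t with
    | zero => simpa [hf0] using left_ne_zero_of_mul hl
    | succ t => exact hf t (by omega)

/-- The positive powers of an acyclic matrix have zero diagonal. -/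
theorem IsAcyclic.pow_apply_self {d : ℕ} {B : Matrix (Fin d) (Fin d) ℝ} (hB : B.IsAcyclic)
    {k : ℕ} (hk : 1 ≤ k) (i : Fin d) : (B ^ k) i i = 0 := by
  by_contra h
  obtain ⟨f, hf0, hfk, hf⟩ := exists_walk_of_pow_apply_ne_zero h
  exact hB ⟨k, f, hk, hfk.trans hf0.symm, hf⟩

/-- For entrywise nonnegative matrices, one path bounds an entry of the product from below. -/
theorem mul_apply_le_mul_apply {n : Type*} [Fintype n] {M N : Matrix n n ℝ}
    (hM : ∀ i j, 0 ≤ M i j) (hN : ∀ i j, 0 ≤ N i j) (i l j : n) :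
    M i l * N l j ≤ (M * N) i j := by
  rw [mul_apply]
  exact Finset.single_le_sum (f := fun l => M i l * N l j)
    (fun l _ => mul_nonneg (hM i l) (hN l j)) (Finset.mem_univ l)

/-- In a nonnegative matrix, a walk along entries that are at least one bounds the corresponding
entry of the power from below by one. -/
theorem one_le_pow_apply_of_walk {n : Type*} [Fintype n] [DecidableEq n] {B : Matrix n n ℝ}
    (hB : ∀ i j, 0 ≤ B i j) {k : ℕ} {f : ℕ → n} (hf : ∀ t < k, 1 ≤ B (f t) (f (t + 1))) :
    1 ≤ (B ^ k) (f 0) (f k) := by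
  induction k with
  | zero => simp
  | succ k ih =>
    rw [pow_succ]
    exact (one_le_mul_of_one_le_of_one_le (ih fun t ht => hf t (by omega))
      (hf k k.lt_succ_self)).trans (mul_apply_le_mul_apply (pow_apply_nonneg hB k) hB _ _ _)

open Filter Topology in
/-- A binary matrix whose powers tend to zero is acyclic. -/
theorem isAcyclic_of_tendsto_pow_zero {d : ℕ} {B : Matrix (Fin d) (Fin d) ℝ}
    (hB : ∀ i j, B i j = 0 ∨ B i j = 1)
    (hlim : ∀ i, Tendsto (fun k : ℕ => (B ^ k) i i) atTop (𝓝 0)) : B.IsAcyclic := by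
  rintro ⟨k, f, hk, hclosed, hf⟩
  have hnonneg : ∀ i j, 0 ≤ B i j := fun i j => by rcases hB i j with h | h <;> simp [h]
  have hcycle : 1 ≤ (B ^ k) (f 0) (f 0) := by
    have := one_le_pow_apply_of_walk hnonneg (f := f) fun t ht => ((hB _ _).resolve_left (hf t ht)).ge
    rwa [hclosed] at this
  have hiter (m : ℕ) : 1 ≤ (B ^ (m * k)) (f 0) (f 0) := by
    rw [mul_comm, pow_mul]
    exact one_le_pow_apply_of_walk (f := fun _ => f 0) (pow_apply_nonneg hnonneg k)
      fun _ _ => hcycle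
  have hsub := (hlim (f 0)).comp (tendsto_id.atTop_mul_const' (by omega : 0 < k))
  exact absurd (ge_of_tendsto' hsub hiter) (by norm_num)

open Filter Topology in
/-- If the powers of `B` tend to zero and `B` is acyclic, then the Neumann series gives
`tr (1 - B)⁻¹ = d`. -/
theorem IsAcyclic.trace_inv_one_sub {d : ℕ} {B : Matrix (Fin d) (Fin d) ℝ} (hB : B.IsAcyclic)
    (hunit : IsUnit (1 - B))
    (hlim : ∀ i j, Tendsto (fun k : ℕ => (B ^ k) i j) atTop (𝓝 0)) :
    trace (1 - B)⁻¹ = (d : ℝ) := by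
  have hpow : Tendsto (fun k : ℕ => B ^ k) atTop (𝓝 0) :=
    tendsto_pi_nhds.mpr fun i => tendsto_pi_nhds.mpr fun j => hlim i j
  have hcont : Continuous fun M : Matrix (Fin d) (Fin d) ℝ => trace ((1 - B)⁻¹ * (1 - M)) := by
    fun_prop
  have htrace := (hcont.tendsto 0).comp hpow
  simp only [sub_zero, mul_one] at htrace
  refine tendsto_nhds_unique htrace (tendsto_const_nhds.congr' ?_)
  filter_upwards [eventually_ge_atTop 1] with m hm
  have hsum : (1 - B)⁻¹ * (1 - B ^ m) = ∑ k ∈ Finset.range m, B ^ k := by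
    rw [← mul_neg_geom_sum B m, nonsing_inv_mul_cancel_left _ _ ((isUnit_iff_isUnit_det _).mp hunit)]
  obtain ⟨m, rfl⟩ := Nat.exists_eq_add_of_le' hm
  have hdiag (k : ℕ) : trace (B ^ (k + 1)) = 0 :=
    Finset.sum_eq_zero fun i _ => hB.pow_apply_self k.succ_pos i
  simp [hsum, Finset.sum_range_succ', hdiag]

end Matrix

theorem binary_spectralRadius_lt_one_acyclic_iff_trace_inv (d : ℕ) (hd : 0 < d)
    (B : Matrix (Fin d) (Fin d) ℝ) (hB : ∀ i j, B i j = 0 ∨ B i j = 1)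
    (hspec : ∀ μ ∈ spectrum ℂ (B.map (algebraMap ℝ ℂ)), ‖μ‖ < 1) :
    IsUnit (1 - B) ∧ (B.IsAcyclic ↔ Matrix.trace (1 - B)⁻¹ = (d : ℝ)) := by
  have hlim := Matrix.tendsto_pow_apply_zero hspec
  have hunit : IsUnit (1 - B) := Matrix.isUnit_one_sub_of_one_notMem_spectrum fun h => by
    simpa using hspec 1 h
  exact ⟨hunit, fun h => h.trace_inv_one_sub hunit hlim,
    fun _ => Matrix.isAcyclic_of_tendsto_pow_zero hB fun i => hlim i i⟩
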